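/- Let k be a field, R a smooth finite-type k-algebra, 𝔭 a prime ideal of R, and κ = Frac(R/𝔭) the residue field of R at 𝔭. Let 𝔪 be the kernel of the multiplication map κ ⊗_k R → κ sending c ⊗ r to c·(r mod 𝔭). Then 𝔪 is a maximal ideal of κ ⊗_k R, and the localization R' = (κ ⊗_k R)_𝔪 is a regular local ring with residue field κ. -/

import Mathlib

noncomputable section

open scoped TensorProduct

/-- A commutative Noetherian local ring is *regular* if its maximal ideal can
be generated by `dim` many elements. -/
def IsRegularLocal (A : Type) [CommRing A] [IsLocalRing A] : Prop :=
  IsNoetherianRing A ∧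
    ∃ s : Finset A, Ideal.span (s : Set A) = IsLocalRing.maximalIdeal A ∧
      ((s.card : ℕ∞) : WithBot ℕ∞) = ringKrullDim A

namespace Stmt12

variable (k : Type) [Field k] (R : Type) [CommRing R] [Algebra k R]
  (𝔭 : Ideal R) [𝔭.IsPrime]

/-- The residue field `κ = Frac(R/𝔭)` of `R` at the prime `𝔭`. -/
abbrev Kappa : Type := FractionRing (R ⧸ 𝔭)

/-- The base change `κ ⊗_k R`. -/
def TotalRing : Type := (Kappa R 𝔭) ⊗[k] R

instance : CommRing (TotalRing k R 𝔭) :=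
  inferInstanceAs (CommRing ((Kappa R 𝔭) ⊗[k] R))

instance : Algebra k (TotalRing k R 𝔭) :=
  inferInstanceAs (Algebra k ((Kappa R 𝔭) ⊗[k] R))

/-- The multiplication map `κ ⊗_k R → κ`, `c ⊗ r ↦ c·(r mod 𝔭)`. -/
def multMap : TotalRing k R 𝔭 →ₐ[k] Kappa R 𝔭 :=
  Algebra.TensorProduct.productMap (AlgHom.id k _)
    ((IsScalarTower.toAlgHom k (R ⧸ 𝔭) _).comp (Ideal.Quotient.mkₐ k 𝔭))

/-- The kernel `𝔪` of the multiplication map `κ ⊗_k R → κ`. -/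
def mIdeal : Ideal (TotalRing k R 𝔭) := RingHom.ker (multMap k R 𝔭)

end Stmt12

open Stmt12

/-- An étale algebra over a regular ring is regular. -/
theorem IsRegularRing.of_etale (P B : Type*) [CommRing P] [CommRing B] [Algebra P B]
    [IsRegularRing P] [Algebra.Etale P B] : IsRegularRing B := by
  have : IsNoetherianRing B := Algebra.FiniteType.isNoetherianRing P B
  refine isRegularRing_iff.mpr fun q hq ↦ ?_
  let p := q.under P
  let : Algebra (Localization.AtPrime p) (Localization.AtPrime q) :=
    (Localization.localRingHom p q (algebraMap P B) rfl).toAlgebra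
  have : Localization.AtPrime.IsLiesOverAlgebra p q := ⟨rfl⟩
  have hmap : p.map (algebraMap P (Localization.AtPrime q)) =
      IsLocalRing.maximalIdeal (Localization.AtPrime q) :=
    ((Algebra.isUnramifiedAt_iff_map_eq P p q).mp inferInstance).2
  have hmap' : (IsLocalRing.maximalIdeal (Localization.AtPrime p)).map
      (algebraMap (Localization.AtPrime p) (Localization.AtPrime q)) =
      IsLocalRing.maximalIdeal (Localization.AtPrime q) := by
    rw [← hmap, ← Localization.AtPrime.map_eq_maximalIdeal, Ideal.map_map,
      ← IsScalarTower.algebraMap_eq]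
  have hfg : Submodule.FG (IsLocalRing.maximalIdeal (Localization.AtPrime p)) :=
    Ideal.fg_of_isNoetherianRing _
  have hspan : (IsLocalRing.maximalIdeal (Localization.AtPrime q)).spanFinrank ≤
      (IsLocalRing.maximalIdeal (Localization.AtPrime p)).spanFinrank := by
    rw [← hmap', ← hfg.generators_ncard]
    nth_rw 1 [← Submodule.span_generators (IsLocalRing.maximalIdeal (Localization.AtPrime p))]
    rw [← Ideal.span, Ideal.map_span]
    exact (Submodule.spanFinrank_span_le_ncard_of_finite (hfg.finite_generators.image _)).trans
      (Set.ncard_image_le hfg.finite_generators)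
  have hheight : p.height ≤ q.height := by
    rw [Ideal.height_eq_height_add_of_liesOver_of_hasGoingDown p q]
    exact le_self_add
  refine IsRegularLocalRing.of_spanFinrank_maximalIdeal_le _ ?_
  calc ((IsLocalRing.maximalIdeal (Localization.AtPrime q)).spanFinrank : WithBot ℕ∞)
      ≤ (IsLocalRing.maximalIdeal (Localization.AtPrime p)).spanFinrank := by
        exact_mod_cast hspan
    _ = p.height := by
        rw [IsRegularLocalRing.spanFinrank_maximalIdeal,
          IsLocalization.AtPrime.ringKrullDim_eq_height p]
    _ ≤ q.height := WithBot.coe_le_coe.mpr hheight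
    _ = ringKrullDim (Localization.AtPrime q) :=
        (IsLocalization.AtPrime.ringKrullDim_eq_height q _).symm

/-- A smooth algebra over a regular ring is regular. -/
theorem IsRegularRing.of_smooth (K S : Type*) [CommRing K] [CommRing S] [Algebra K S]
    [IsRegularRing K] [Algebra.Smooth K S] : IsRegularRing S := by
  have : IsNoetherianRing S := Algebra.FiniteType.isNoetherianRing K S
  refine isRegularRing_iff.mpr fun p hp ↦ ?_
  obtain ⟨f, hf, n, _, _, _⟩ :=
    Algebra.IsSmoothAt.exists_isStandardEtale_mvPolynomial (R := K) (p := p)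
  have : IsRegularRing (Localization.Away f) := .of_etale (MvPolynomial (Fin n) K) _
  have hdisj : Disjoint (Submonoid.powers f : Set S) (p : Set S) :=
    (Ideal.disjoint_powers_iff_notMem_of_isPrime _).mpr hf
  let q := p.map (algebraMap S (Localization.Away f))
  have : q.IsPrime := IsLocalization.isPrime_of_isPrime_disjoint (.powers f) _ _ hp hdisj
  have : IsLocalization.AtPrime (Localization.AtPrime q) p := by
    convert IsLocalization.isLocalization_isLocalization_atPrime_isLocalization (.powers f)
      (Localization.AtPrime q) q
    exact (IsLocalization.under_map_of_isPrime_disjoint (.powers f) _ hp hdisj).symm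
  exact IsRegularLocalRing.of_ringEquiv (IsLocalization.algEquiv p.primeCompl
    (Localization.AtPrime q) (Localization.AtPrime p)).toRingEquiv

theorem IsRegularLocalRing.isRegularLocal (A : Type) [CommRing A] [IsRegularLocalRing A] :
    IsRegularLocal A := by
  have hfg : Submodule.FG (IsLocalRing.maximalIdeal A) :=
    Ideal.fg_of_isNoetherianRing _
  refine ⟨inferInstance, hfg.finite_generators.toFinset, ?_, ?_⟩
  · rw [Set.Finite.coe_toFinset]
    exact Submodule.span_generators _
  · rw [← Set.ncard_eq_toFinset_card _ hfg.finite_generators, hfg.generators_ncard]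
    exact IsRegularLocalRing.spanFinrank_maximalIdeal

theorem Stmt12.multMap_surjective (k : Type) [Field k] (R : Type) [CommRing R] [Algebra k R]
    (𝔭 : Ideal R) [𝔭.IsPrime] : Function.Surjective (multMap k R 𝔭) := fun c ↦
  ⟨(c ⊗ₜ[k] (1 : R) : Kappa R 𝔭 ⊗[k] R), by
    refine (Algebra.TensorProduct.productMap_apply_tmul _ _ c (1 : R)).trans ?_
    simp⟩

/-- Let `k` be a field, `R` a smooth finite-type `k`-algebra, `𝔭` a prime
ideal of `R` and `κ = Frac(R/𝔭)` the residue field of `R` at `𝔭`.  Let `𝔪` be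
the kernel of the multiplication map `κ ⊗_k R → κ`, `c ⊗ r ↦ c·(r mod 𝔭)`.
Then `𝔪` is a maximal ideal of `κ ⊗_k R`, and the localization
`R' = (κ ⊗_k R)_𝔪` is a regular local ring with residue field `κ`. -/
theorem localization_at_kernel_of_multiplication_is_regular_local
    (k : Type) [Field k] (R : Type) [CommRing R] [Algebra k R]
    [Algebra.Smooth k R] (hft : Algebra.FiniteType k R)
    (𝔭 : Ideal R) [𝔭.IsPrime] :
    (mIdeal k R 𝔭).IsMaximal ∧
    ∀ hp : (mIdeal k R 𝔭).IsPrime,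
      letI := hp
      IsRegularLocal (Localization.AtPrime (mIdeal k R 𝔭)) ∧
      Nonempty
        (IsLocalRing.ResidueField (Localization.AtPrime (mIdeal k R 𝔭)) ≃+*
          Kappa R 𝔭) := by
  have hsurj := multMap_surjective k R 𝔭
  have hmax : (mIdeal k R 𝔭).IsMaximal := RingHom.ker_isMaximal_of_surjective _ hsurj
  refine ⟨hmax, fun hp ↦ ⟨?_, ⟨?_⟩⟩⟩
  · have : IsRegularRing (TotalRing k R 𝔭) :=
      IsRegularRing.of_smooth (Kappa R 𝔭) (Kappa R 𝔭 ⊗[k] R)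
    exact IsRegularLocalRing.isRegularLocal _
  · exact (IsLocalization.AtPrime.equivQuotMaximalIdeal (mIdeal k R 𝔭)
      (Localization.AtPrime (mIdeal k R 𝔭))).symm.trans
      (RingHom.quotientKerEquivOfSurjective (f := (multMap k R 𝔭).toRingHom) hsurj)

end
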